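/- arXiv:2512.14231 — 3 statements merged into one kernel-verified Lean document; each statement's English description precedes it below -/
import Mathlib

section
/- Let X be a finite-dimensional real inner product space and A : X × X → ℝ a bilinear form. Assume there exists α > 0 such that for every x ∈ X, sup over y ∈ X, y ≠ 0, of A(x,y)/‖y‖ is at least α·‖x‖. Then for every linear functional F : X → ℝ there exists a unique x ∈ X with A(x,y) = F(y) for all y ∈ X, and this x satisfies ‖x‖ ≤ α⁻¹ · (sup over y ≠ 0 of |F(y)|/‖y‖). -/
/-- A bilinear form on a finite-dimensional space with trivial left kernel identifies the space
with its dual. -/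
theorem LinearMap.bijective_of_injective_toDual {K V : Type*} [Field K] [AddCommGroup V]
    [Module K V] [FiniteDimensional K V] (A : V →ₗ[K] V →ₗ[K] K) (hA : Function.Injective A) :
    Function.Bijective A :=
  ⟨hA, (LinearMap.injective_iff_surjective_of_finrank_eq_finrank
    (Subspace.dual_finrank_eq (K := K) (V := V)).symm).1 hA⟩

/-- The quotients `|F y| / ‖y‖` of a functional on a finite-dimensional space are bounded. -/
theorem LinearMap.bddAbove_abs_div_norm {X : Type*} [NormedAddCommGroup X] [NormedSpace ℝ X]
    [FiniteDimensional ℝ X] (F : X →ₗ[ℝ] ℝ) :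
    BddAbove {r : ℝ | ∃ y : X, y ≠ 0 ∧ r = |F y| / ‖y‖} := by
  refine ⟨‖F.toContinuousLinearMap‖, ?_⟩
  rintro _ ⟨y, -, rfl⟩
  exact F.toContinuousLinearMap.ratio_le_opNorm y

/-- **Finite-dimensional well-posedness under an inf-sup condition.**
Let `X` be a finite-dimensional real inner product space and `A` a bilinear
form on `X` satisfying the inf-sup condition with constant `α > 0`:
for every `x`, `sup_{y ≠ 0} A x y / ‖y‖ ≥ α‖x‖` (encoded as: every
`r < α‖x‖` is strictly exceeded by some `A x y / ‖y‖` with `y ≠ 0`).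
Then for every linear functional `F : X → ℝ` there is a unique `x` with
`A x y = F y` for all `y`, and this `x` satisfies
`‖x‖ ≤ α⁻¹ · sup_{y ≠ 0} |F y| / ‖y‖`. -/
theorem stmt_1
    {X : Type*} [NormedAddCommGroup X] [InnerProductSpace ℝ X] [FiniteDimensional ℝ X]
    (A : X →ₗ[ℝ] X →ₗ[ℝ] ℝ)
    (α : ℝ) (hα : 0 < α)
    (hinfsup : ∀ x : X, ∀ r : ℝ, r < α * ‖x‖ → ∃ y : X, y ≠ 0 ∧ r < A x y / ‖y‖) :
    ∀ F : X →ₗ[ℝ] ℝ,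
      (∃! x : X, ∀ y : X, A x y = F y) ∧
        ∀ x : X, (∀ y : X, A x y = F y) →
          ‖x‖ ≤ α⁻¹ * sSup {r : ℝ | ∃ y : X, y ≠ 0 ∧ r = |F y| / ‖y‖} := by
  intro F
  have hinj : Function.Injective A := by
    refine (injective_iff_map_eq_zero A).2 fun x hx => ?_
    by_contra hne
    obtain ⟨y, -, hy⟩ := hinfsup x 0 (mul_pos hα (norm_pos_iff.2 hne))
    simp [hx] at hy
  refine ⟨?_, fun x hx => ?_⟩
  · simpa only [LinearMap.ext_iff] using
      (LinearMap.bijective_of_injective_toDual A hinj).existsUnique F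
  · rw [le_inv_mul_iff₀ hα]
    refine le_of_forall_lt fun r hr => ?_
    obtain ⟨y, hy0, hy⟩ := hinfsup x r hr
    calc r < A x y / ‖y‖ := hy
      _ = F y / ‖y‖ := by rw [hx]
      _ ≤ |F y| / ‖y‖ := by gcongr; exact le_abs_self _
      _ ≤ _ := le_csSup F.bddAbove_abs_div_norm ⟨y, hy0, rfl⟩
end

section
/- Let Q and V be real normed spaces, Q_h ⊆ Q and V_h ⊆ V subspaces, and b : Q × V → ℝ a bilinear form satisfying |b(q,v)| ≤ ‖q‖·‖v‖ for all q ∈ Q, v ∈ V. Assume there exists β₁ > 0 such that for every q_h ∈ Q_h, sup over v ∈ V_h, v ≠ 0, of b(q_h, v)/‖v‖ is at least β₁·‖q_h‖. Let p ∈ Q, p_h ∈ Q_h, and E ≥ 0 be such that |b(p − p_h, v)| ≤ E·‖v‖ for all v ∈ V_h. Then for every q_h ∈ Q_h one has ‖p − p_h‖ ≤ (1 + 1/β₁)·‖p − q_h‖ + E/β₁. -/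
/-- **Abstract pressure-error estimate.**
Let `Q`, `V` be real normed spaces, `Qh ⊆ Q`, `Vh ⊆ V` subspaces, and
`b : Q × V → ℝ` a bilinear form with `|b q v| ≤ ‖q‖‖v‖`.  Assume the
discrete inf-sup condition with constant `β₁ > 0`: for every `qh ∈ Qh`,
`sup_{v ∈ Vh, v ≠ 0} b qh v / ‖v‖ ≥ β₁‖qh‖` (encoded as: every
`r < β₁‖qh‖` is strictly exceeded by some `b qh v / ‖v‖`).  If `p ∈ Q`,
`ph ∈ Qh` and `E ≥ 0` satisfy `|b (p - ph) v| ≤ E‖v‖` for all `v ∈ Vh`,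
then `‖p - ph‖ ≤ (1 + 1/β₁)‖p - qh‖ + E/β₁` for every `qh ∈ Qh`. -/
theorem stmt_3
    {Q V : Type*} [NormedAddCommGroup Q] [NormedSpace ℝ Q]
    [NormedAddCommGroup V] [NormedSpace ℝ V]
    (Qh : Submodule ℝ Q) (Vh : Submodule ℝ V)
    (b : Q →ₗ[ℝ] V →ₗ[ℝ] ℝ)
    (hbbdd : ∀ (q : Q) (v : V), |b q v| ≤ ‖q‖ * ‖v‖)
    (β₁ : ℝ) (hβ₁ : 0 < β₁)
    (hinfsup : ∀ qh ∈ Qh, ∀ r : ℝ, r < β₁ * ‖qh‖ →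
      ∃ v ∈ Vh, v ≠ 0 ∧ r < b qh v / ‖v‖)
    (p ph : Q) (hph : ph ∈ Qh)
    (E : ℝ) (hE : 0 ≤ E)
    (hres : ∀ v ∈ Vh, |b (p - ph) v| ≤ E * ‖v‖) :
    ∀ qh ∈ Qh, ‖p - ph‖ ≤ (1 + 1 / β₁) * ‖p - qh‖ + E / β₁ := by
  intro qh hqh
  have hdiscrete : β₁ * ‖qh - ph‖ ≤ ‖p - qh‖ + E := by
    by_contra! hlt
    obtain ⟨v, hv, hv0, hbv⟩ := hinfsup _ (Qh.sub_mem hqh hph) _ hlt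
    rw [lt_div_iff₀ (norm_pos_iff.mpr hv0)] at hbv
    have hsplit : b (qh - ph) v = b (p - ph) v - b (p - qh) v := by
      rw [← LinearMap.sub_apply, ← map_sub, sub_sub_sub_cancel_left]
    linarith [le_of_abs_le (hres v hv), neg_le_of_abs_le (hbbdd (p - qh) v)]
  calc ‖p - ph‖ ≤ ‖p - qh‖ + ‖qh - ph‖ := norm_sub_le_norm_sub_add_norm_sub p qh ph
    _ ≤ ‖p - qh‖ + (‖p - qh‖ + E) / β₁ := by
      gcongr
      rwa [le_div_iff₀' hβ₁]
    _ = (1 + 1 / β₁) * ‖p - qh‖ + E / β₁ := by ring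
end

section
/- Let (Ω, μ) be a measure space, h > 0, and let u, ω, β : Ω → ℝ³ and τ : Ω → ℝ be measurable functions with τ ≥ 0 μ-almost everywhere, B := the essential supremum of x ↦ ‖β(x)‖ finite, and ‖β(x)‖ ≤ h·τ(x) for μ-almost every x ∈ Ω. Assume ∫_Ω ‖u‖² dμ < ∞, ∫_Ω ‖ω‖² dμ < ∞, and ∫_Ω τ·‖u‖² dμ < ∞. Then |∫_Ω ⟨ω(x) × β(x), u(x)⟩ dμ(x)| ≤ 3·h·B·∫_Ω ‖ω(x)‖² dμ(x) + (1/4)·∫_Ω τ(x)·‖u(x)‖² dμ(x), where × denotes the cross product, ⟨·,·⟩ the Euclidean inner product, and ‖·‖ the Euclidean norm on ℝ³. -/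
open MeasureTheory
open scoped ENNReal RealInnerProductSpace

/-- The cross product on `ℝ³`, realized on `EuclideanSpace ℝ (Fin 3)` so that
`‖·‖` is the Euclidean norm and `⟪·,·⟫` the Euclidean inner product. -/
noncomputable def cross3 (a b : EuclideanSpace ℝ (Fin 3)) : EuclideanSpace ℝ (Fin 3) :=
  (WithLp.equiv 2 (Fin 3 → ℝ)).symm
    ![a 1 * b 2 - a 2 * b 1, a 2 * b 0 - a 0 * b 2, a 0 * b 1 - a 1 * b 0]

/-- The cross product is bounded by the product of the norms. -/
theorem norm_cross3_le (a b : EuclideanSpace ℝ (Fin 3)) : ‖cross3 a b‖ ≤ ‖a‖ * ‖b‖ := by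
  refine (pow_le_pow_iff_left₀ (by positivity) (by positivity) two_ne_zero).1 ?_
  rw [mul_pow, EuclideanSpace.real_norm_sq_eq, EuclideanSpace.real_norm_sq_eq,
    EuclideanSpace.real_norm_sq_eq]
  simp only [cross3, Fin.sum_univ_three, WithLp.equiv_symm_apply, Matrix.cons_val]
  nlinarith [sq_nonneg (a 0 * b 0 + a 1 * b 1 + a 2 * b 2)]

/-- Weighted Young inequality for the scalar triple product. -/
theorem abs_inner_cross3_le {h t B : ℝ} (hh : 0 < h) {u w b : EuclideanSpace ℝ (Fin 3)}
    (hbB : ‖b‖ ≤ B) (hbt : ‖b‖ ≤ h * t) :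
    |⟪cross3 w b, u⟫| ≤ 3 * h * B * ‖w‖ ^ 2 + (1 / 4) * (t * ‖u‖ ^ 2) := by
  have htriple : |⟪cross3 w b, u⟫| ≤ ‖w‖ * ‖b‖ * ‖u‖ :=
    (abs_real_inner_le_norm _ _).trans
      (mul_le_mul_of_nonneg_right (norm_cross3_le w b) (norm_nonneg u))
  refine htriple.trans (le_of_mul_le_mul_left ?_ hh)
  calc h * (‖w‖ * ‖b‖ * ‖u‖)
      ≤ ‖b‖ * (3 * h ^ 2 * ‖w‖ ^ 2) + ‖b‖ * ((1 / 4) * ‖u‖ ^ 2) := by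
        have hsq : 0 ≤ ‖b‖ * ((h * ‖w‖ - ‖u‖ / 2) ^ 2 + 2 * (h * ‖w‖) ^ 2) := by positivity
        linarith
    _ ≤ B * (3 * h ^ 2 * ‖w‖ ^ 2) + h * t * ((1 / 4) * ‖u‖ ^ 2) := by gcongr
    _ = h * (3 * h * B * ‖w‖ ^ 2 + (1 / 4) * (t * ‖u‖ ^ 2)) := by ring

/-- **Duality estimate for the fine-scale advection term.**
Let `(Ω, μ)` be a measure space, `h > 0`, `u, ω, β : Ω → ℝ³` and `τ : Ω → ℝ`
measurable, with `τ ≥ 0` a.e., with `B := essSup ‖β‖` finite, and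
`‖β x‖ ≤ h·τ x` a.e.  Assume `‖u‖², ‖ω‖²` and `τ‖u‖²` are integrable.  Then
`|∫ ⟪ω × β, u⟫ dμ| ≤ 3·h·B·∫ ‖ω‖² dμ + (1/4)·∫ τ‖u‖² dμ`. -/
theorem stmt_7
    {Ω : Type*} [MeasurableSpace Ω] (μ : Measure Ω)
    (h : ℝ) (hh : 0 < h)
    (u ω β : Ω → EuclideanSpace ℝ (Fin 3)) (τ : Ω → ℝ)
    (hu : Measurable u) (hω : Measurable ω) (hβ : Measurable β) (hτ : Measurable τ)
    (hτ0 : ∀ᵐ x ∂μ, 0 ≤ τ x)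
    (B : ℝ)
    (hBfin : essSup (fun x => (‖β x‖₊ : ℝ≥0∞)) μ ≠ ⊤)
    (hB : B = (essSup (fun x => (‖β x‖₊ : ℝ≥0∞)) μ).toReal)
    (hβτ : ∀ᵐ x ∂μ, ‖β x‖ ≤ h * τ x)
    (hu2 : Integrable (fun x => ‖u x‖ ^ 2) μ)
    (hω2 : Integrable (fun x => ‖ω x‖ ^ 2) μ)
    (hτu2 : Integrable (fun x => τ x * ‖u x‖ ^ 2) μ) :
    |∫ x, ⟪cross3 (ω x) (β x), u x⟫ ∂μ| ≤
      3 * h * B * ∫ x, ‖ω x‖ ^ 2 ∂μ + (1 / 4) * ∫ x, τ x * ‖u x‖ ^ 2 ∂μ := by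
  have hβB : ∀ᵐ x ∂μ, ‖β x‖ ≤ B := by
    filter_upwards [ENNReal.ae_le_essSup (μ := μ) fun x => (‖β x‖₊ : ℝ≥0∞)] with x hx
    simpa [hB] using ENNReal.toReal_mono hBfin hx
  have hωB := hω2.const_mul (3 * h * B)
  have hτu := hτu2.const_mul (1 / 4)
  rw [← integral_const_mul, ← integral_const_mul, ← integral_add hωB hτu]
  rw [← Real.norm_eq_abs]
  refine norm_integral_le_of_norm_le (hωB.add hτu) ?_
  filter_upwards [hβB, hβτ] with x hxB hxτ
  exact abs_inner_cross3_le hh hxB hxτ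
end
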